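/- Let n ≥ 2 and let f be a homogeneous cubic polynomial on ℝⁿ satisfying the eiconal equation |∇f(x)|² = 9|x|⁴ for all x ∈ ℝⁿ. Then there exists an orthogonal transformation U ∈ O(n), a homogeneous quadratic polynomial A and a homogeneous cubic polynomial B, both in the variables x̄ = (x₁, …, x_{n−1}), such that f(Ux) = xₙ³ + 3xₙA(x̄) + 3B(x̄) for all x ∈ ℝⁿ. -/

import Mathlib

open MvPolynomial

namespace MvPolynomial

/-- A polynomial over an infinite domain whose evaluation is homogeneous of degree `d` is a
homogeneous polynomial of degree `d`. -/
theorem isHomogeneous_of_eval_smul {σ R : Type*} [CommRing R] [IsDomain R] [Infinite R]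
    {f : MvPolynomial σ R} {d : ℕ}
    (h : ∀ (t : R) (x : σ → R), eval (t • x) f = t ^ d * eval x f) : f.IsHomogeneous d := by
  suffices hf : homogeneousComponent d f = f from hf ▸ homogeneousComponent_isHomogeneous d f
  refine MvPolynomial.funext fun x ↦ ?_
  have hcomp (i : ℕ) (t : R) : eval (t • x) (homogeneousComponent i f) =
      t ^ i * eval x (homogeneousComponent i f) := by
    rw [eval_eq, eval_eq, Finset.mul_sum]
    refine Finset.sum_congr rfl fun m hm ↦ ?_
    have hdeg : ∑ j ∈ m.support, m j = i := by
      have := homogeneousComponent_isHomogeneous i f (mem_support_iff.1 hm)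
      rwa [Finsupp.weight_apply, Finsupp.sum, Finset.sum_congr rfl] at this
      simp
    simp only [Pi.smul_apply, smul_eq_mul, mul_pow, Finset.prod_mul_distrib,
      Finset.prod_pow_eq_pow_sum, hdeg]
    ring
  have hpoly : ∑ i ∈ Finset.range (f.totalDegree + 1),
      Polynomial.monomial i (eval x (homogeneousComponent i f)) =
      Polynomial.monomial d (eval x f) := by
    refine Polynomial.funext fun t ↦ ?_
    simp only [Polynomial.eval_finsetSum, Polynomial.eval_monomial]
    rw [mul_comm _ (t ^ d), ← h]
    conv_rhs => rw [← sum_homogeneousComponent f, map_sum]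
    exact Finset.sum_congr rfl fun i _ ↦ by rw [hcomp, mul_comm]
  have hcoeff := congrArg (Polynomial.coeff · d) hpoly
  simp only [Polynomial.finsetSum_coeff, Polynomial.coeff_monomial, Finset.sum_ite_eq',
    Finset.mem_range, if_true] at hcoeff
  split_ifs at hcoeff with hd
  · exact hcoeff
  · rw [← hcoeff, homogeneousComponent_eq_zero _ _ (by omega), map_zero]

section Line

variable {σ R : Type*} [CommRing R]

/-- The restriction of `f` to the line `t ↦ x + t • y`. -/
noncomputable def restrictLine (f : MvPolynomial σ R) (x y : σ → R) : Polynomial R :=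
  aeval (fun i ↦ Polynomial.C (x i) + Polynomial.C (y i) * Polynomial.X) f

theorem eval_restrictLine (f : MvPolynomial σ R) (x y : σ → R) (t : R) :
    (f.restrictLine x y).eval t = eval (x + t • y) f := by
  induction f using MvPolynomial.induction_on with
  | C a => simp [restrictLine]
  | add p q hp hq => simp_all [restrictLine]
  | mul_X p i hp =>
    rw [restrictLine] at hp ⊢
    simp [hp]; ring

theorem derivative_restrictLine [Fintype σ] (f : MvPolynomial σ R) (x y : σ → R) :
    (f.restrictLine x y).derivative =
      ∑ i, Polynomial.C (y i) * (pderiv i f).restrictLine x y := by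
  classical
  induction f using MvPolynomial.induction_on with
  | C a => simp [restrictLine]
  | add p q hp hq => simp_all [restrictLine, mul_add, Finset.sum_add_distrib]
  | mul_X p i hp =>
    have hmul (q r : MvPolynomial σ R) :
      (q * r).restrictLine x y = q.restrictLine x y * r.restrictLine x y := map_mul _ _ _
    have hadd (q r : MvPolynomial σ R) :
      (q + r).restrictLine x y = q.restrictLine x y + r.restrictLine x y := map_add _ _ _
    have hX : (X i : MvPolynomial σ R).restrictLine x y =
      Polynomial.C (x i) + Polynomial.C (y i) * Polynomial.X := aeval_X _ _
    have hXi : ∑ j, Polynomial.C (y j) * (pderiv j (X i : MvPolynomial σ R)).restrictLine x y =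
        Polynomial.C (y i) := by
      rw [Finset.sum_eq_single i (fun j _ hj ↦ by simp [pderiv_X_of_ne hj.symm, restrictLine])
        (by simp)]
      simp [restrictLine]
    have hterm (j : σ) : Polynomial.C (y j) * (pderiv j (p * X i)).restrictLine x y =
        p.restrictLine x y * (Polynomial.C (y j) * (pderiv j (X i)).restrictLine x y) +
        (X i : MvPolynomial σ R).restrictLine x y *
          (Polynomial.C (y j) * (pderiv j p).restrictLine x y) := by
      rw [Derivation.leibniz, smul_eq_mul, smul_eq_mul, hadd, hmul, hmul]
      ring
    simp only [hterm, Finset.sum_add_distrib, ← Finset.mul_sum, hXi, ← hp]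
    rw [hmul, Polynomial.derivative_mul, hX]
    simp
    ring

theorem natDegree_restrictLine_le {f : MvPolynomial σ R} {d : ℕ} (hf : f.totalDegree ≤ d)
    (x y : σ → R) : (f.restrictLine x y).natDegree ≤ d := by
  simpa [restrictLine] using aeval_natDegree_le f hf
    (fun i ↦ Polynomial.C (x i) + Polynomial.C (y i) * Polynomial.X) (n := 1)
    fun i ↦ by compute_degree

theorem coeff_zero_restrictLine (f : MvPolynomial σ R) (x y : σ → R) :
    (f.restrictLine x y).coeff 0 = eval x f := by
  simp [Polynomial.coeff_zero_eq_eval_zero, eval_restrictLine]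

theorem coeff_one_restrictLine [Fintype σ] (f : MvPolynomial σ R) (x y : σ → R) :
    (f.restrictLine x y).coeff 1 = ∑ i, y i * eval x (pderiv i f) := by
  have h := Polynomial.coeff_derivative (f.restrictLine x y) 0
  rw [derivative_restrictLine, Polynomial.coeff_zero_eq_eval_zero] at h
  simpa [Polynomial.eval_finsetSum, eval_restrictLine] using h.symm

end Line

section Cubic

variable {σ : Type*} [Fintype σ] {f : MvPolynomial σ ℝ}

/-- The binomial expansion of a cubic form. -/
theorem eval_add_smul_of_cubic
    (hf : ∀ (t : ℝ) (x : σ → ℝ), eval (t • x) f = t ^ 3 * eval x f) (x y : σ → ℝ) (t : ℝ) :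
    eval (x + t • y) f = eval x f + t * ∑ i, y i * eval x (pderiv i f) +
      t ^ 2 * ∑ i, x i * eval y (pderiv i f) + t ^ 3 * eval y f := by
  have hdeg := (isHomogeneous_of_eval_smul hf).totalDegree_le
  have expand (x y : σ → ℝ) (t : ℝ) : eval (x + t • y) f =
      eval x f + (∑ i, y i * eval x (pderiv i f)) * t +
        (f.restrictLine x y).coeff 2 * t ^ 2 + (f.restrictLine x y).coeff 3 * t ^ 3 := by
    rw [← eval_restrictLine, Polynomial.eval_eq_sum_range'
      (Nat.lt_succ_of_le (natDegree_restrictLine_le hdeg x y)), ← coeff_one_restrictLine,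
      ← coeff_zero_restrictLine f x y]
    simp [Finset.sum_range_succ]
  have flip (t : ℝ) (ht : t ≠ 0) : eval (x + t • y) f = t ^ 3 * eval (y + t⁻¹ • x) f := by
    rw [← hf, smul_add, smul_smul, mul_inv_cancel₀ ht, one_smul, add_comm]
  have h1 := flip 1 (by norm_num)
  have h2 := flip (-1) (by norm_num)
  have h3 := flip 2 (by norm_num)
  have h4 := flip (-2) (by norm_num)
  rw [expand x y, expand y x] at h1 h2 h3 h4
  norm_num at h1 h2 h3 h4
  have hc2 : (f.restrictLine x y).coeff 2 = ∑ i, x i * eval y (pderiv i f) := by linarith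
  have hc3 : (f.restrictLine x y).coeff 3 = eval y f := by linarith
  rw [expand, hc2, hc3]
  ring

theorem sum_sq_inv_sqrt_smul {x : σ → ℝ} (hx : 0 < ∑ i, x i ^ 2) :
    ∑ i, ((√(∑ i, x i ^ 2))⁻¹ • x) i ^ 2 = 1 := by
  simp only [Pi.smul_apply, smul_eq_mul, mul_pow, ← Finset.mul_sum, inv_pow,
    Real.sq_sqrt hx.le]
  exact inv_mul_cancel₀ hx.ne'

theorem exists_isMaxOn_unit_sphere [Nonempty σ] (f : MvPolynomial σ ℝ) :
    ∃ e : σ → ℝ, ∑ i, e i ^ 2 = 1 ∧ ∀ x : σ → ℝ, ∑ i, x i ^ 2 = 1 → eval x f ≤ eval e f := by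
  obtain ⟨e, he, hmax⟩ := (isCompact_sphere (0 : EuclideanSpace ℝ σ) 1).exists_isMaxOn
    (NormedSpace.sphere_nonempty.2 zero_le_one)
    (f := fun x ↦ eval x.ofLp f)
    ((MvPolynomial.continuous_eval f).comp (PiLp.continuous_ofLp 2 _)).continuousOn
  have hmem (x : σ → ℝ) : WithLp.toLp 2 x ∈ Metric.sphere (0 : EuclideanSpace ℝ σ) 1 ↔
      ∑ i, x i ^ 2 = 1 := by
    simp [EuclideanSpace.norm_eq]
  exact ⟨e.ofLp, (hmem _).1 he, fun x hx ↦ hmax ((hmem x).2 hx)⟩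

/-- At a maximum point `e` of a cubic form on the unit sphere, the derivative vanishes in every
direction tangent to the sphere. -/
theorem sum_mul_pderiv_eq_zero_of_isMax
    (hf : ∀ (t : ℝ) (x : σ → ℝ), eval (t • x) f = t ^ 3 * eval x f) {e : σ → ℝ}
    (he : ∑ i, e i ^ 2 = 1) (hmax : ∀ x : σ → ℝ, ∑ i, x i ^ 2 = 1 → eval x f ≤ eval e f)
    {v : σ → ℝ} (hv : ∑ i, e i * v i = 0) : ∑ i, v i * eval e (pderiv i f) = 0 := by
  set s := ∑ i, v i ^ 2
  have hs : 0 ≤ s := Finset.sum_nonneg fun i _ ↦ sq_nonneg _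
  have hnorm (t : ℝ) : ∑ i, (e + t • v) i ^ 2 = 1 + t ^ 2 * s := by
    have (i : σ) : (e + t • v) i ^ 2 = e i ^ 2 + 2 * t * (e i * v i) + t ^ 2 * v i ^ 2 := by
      simp only [Pi.add_apply, Pi.smul_apply, smul_eq_mul]; ring
    simp only [this, Finset.sum_add_distrib, ← Finset.mul_sum, he, hv]
    ring
  have hbound (t : ℝ) : eval (e + t • v) f ≤ √(1 + t ^ 2 * s) ^ 3 * eval e f := by
    have hpos : 0 < 1 + t ^ 2 * s := by positivity
    have h := hmax _ (sum_sq_inv_sqrt_smul (x := e + t • v) (hnorm t ▸ hpos))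
    rw [hnorm, hf, inv_pow, inv_mul_le_iff₀ (by positivity)] at h
    exact h
  have hloc : IsLocalMax
      (fun t ↦ (f.restrictLine e v).eval t - √(1 + t ^ 2 * s) ^ 3 * eval e f) 0 :=
    .of_forall fun t ↦ by simpa [eval_restrictLine] using hbound t
  have hderiv : HasDerivAt (fun t : ℝ ↦ √(1 + t ^ 2 * s) ^ 3 * eval e f) 0 0 := by
    have h : HasDerivAt (fun t : ℝ ↦ 1 + t ^ 2 * s) 0 0 := by
      simpa using (((hasDerivAt_id (0 : ℝ)).pow 2).mul_const s).const_add 1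
    simpa using ((h.sqrt (by simp)).pow 3).mul_const (eval e f)
  have h0 := hloc.hasDerivAt_eq_zero (((f.restrictLine e v).hasDerivAt 0).sub hderiv)
  simpa [derivative_restrictLine, Polynomial.eval_finsetSum, eval_restrictLine] using h0

/-- The maximum on the unit sphere of an eiconal cubic is `1`. -/
theorem eval_eq_one_of_isMax_of_eiconal
    (hf : ∀ (t : ℝ) (x : σ → ℝ), eval (t • x) f = t ^ 3 * eval x f)
    (hgrad : ∀ x : σ → ℝ, ∑ i, (eval x (pderiv i f)) ^ 2 = 9 * (∑ i, x i ^ 2) ^ 2)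
    {e : σ → ℝ} (he : ∑ i, e i ^ 2 = 1)
    (hmax : ∀ x : σ → ℝ, ∑ i, x i ^ 2 = 1 → eval x f ≤ eval e f) : eval e f = 1 := by
  have heuler : ∑ i, e i * eval e (pderiv i f) = 3 * eval e f := by
    simpa using congrArg (eval e) (isHomogeneous_of_eval_smul hf).sum_X_mul_pderiv
  have hneg : -eval e f ≤ eval e f := by
    have h := hf (-1) e
    rw [neg_one_smul] at h
    have := hmax (-e) (by simpa using he)
    linarith
  have hG := hgrad e
  have hv : ∑ i, e i * (eval e (pderiv i f) - 3 * eval e f * e i) = 0 := by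
    have (i : σ) : e i * (eval e (pderiv i f) - 3 * eval e f * e i) =
      e i * eval e (pderiv i f) - 3 * eval e f * e i ^ 2 := by ring
    simp only [this, Finset.sum_sub_distrib, ← Finset.mul_sum, heuler, he]
    ring
  have hcrit := sum_mul_pderiv_eq_zero_of_isMax hf he hmax hv
  have (i : σ) : (eval e (pderiv i f) - 3 * eval e f * e i) * eval e (pderiv i f) =
      eval e (pderiv i f) ^ 2 - 3 * eval e f * (e i * eval e (pderiv i f)) := by ring
  simp only [this, Finset.sum_sub_distrib, ← Finset.mul_sum, heuler, hG, he] at hcrit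
  nlinarith

end Cubic

end MvPolynomial

/-- Every unit vector of `ℝⁿ` is a prescribed column of some orthogonal matrix. -/
theorem Matrix.exists_mem_orthogonalGroup_col_eq {ι : Type*} [Fintype ι] [DecidableEq ι]
    (k : ι) {e : ι → ℝ} (he : ∑ i, e i ^ 2 = 1) :
    ∃ U ∈ Matrix.orthogonalGroup ι ℝ, ∀ i, U i k = e i := by
  have hnorm : ‖WithLp.toLp 2 e‖ = 1 := by simp [EuclideanSpace.norm_eq, he]
  have hon : Orthonormal ℝ
      (({k} : Set ι).domRestrict fun _ ↦ (WithLp.toLp 2 e : EuclideanSpace ℝ ι)) :=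
    ⟨fun _ ↦ hnorm, fun i j hij ↦ (hij (Subsingleton.elim i j)).elim⟩
  obtain ⟨b, hb⟩ := hon.exists_orthonormalBasis_extension_of_card_eq (by simp)
  refine ⟨.of fun i j ↦ b j i, ?_, fun i ↦ by simp [hb k rfl]⟩
  rw [Matrix.mem_orthogonalGroup_iff']
  ext i j
  have h := orthonormal_iff_ite.1 b.orthonormal i j
  simpa [Matrix.mul_apply, Matrix.one_apply, PiLp.inner_apply, mul_comm] using h

/-- Any homogeneous cubic polynomial on `ℝⁿ` (`n ≥ 2`) satisfying the eiconal equation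
can be brought by an orthogonal change of variables to the normal form
`f(Ux) = xₙ³ + 3xₙA(x̄) + 3B(x̄)`, with `A` a quadratic and `B` a cubic form in
`x̄ = (x₁, …, x_{n−1})`. -/
theorem eiconal_cubic_normal_form (n : ℕ) (hn : 2 ≤ n) (f : MvPolynomial (Fin n) ℝ)
    (hcubic : ∀ (t : ℝ) (x : Fin n → ℝ), eval (t • x) f = t ^ 3 * eval x f)
    (heiconal : ∀ x : Fin n → ℝ,
      ∑ i, (eval x (pderiv i f)) ^ 2 = 9 * (∑ i, x i ^ 2) ^ 2) :
    ∃ U : Matrix (Fin n) (Fin n) ℝ, U ∈ Matrix.orthogonalGroup (Fin n) ℝ ∧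
      ∃ A B : MvPolynomial (Fin (n - 1)) ℝ, A.IsHomogeneous 2 ∧ B.IsHomogeneous 3 ∧
        ∀ x : Fin n → ℝ,
          eval (U.mulVec x) f =
            x ⟨n - 1, by omega⟩ ^ 3 +
              3 * x ⟨n - 1, by omega⟩ * eval (fun i : Fin (n - 1) => x ⟨i.1, by omega⟩) A +
              3 * eval (fun i : Fin (n - 1) => x ⟨i.1, by omega⟩) B := by
  obtain ⟨m, rfl⟩ : ∃ m, n = m + 1 := ⟨n - 1, by omega⟩
  change ∃ U : Matrix (Fin (m + 1)) (Fin (m + 1)) ℝ, U ∈ Matrix.orthogonalGroup _ ℝ ∧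
    ∃ A B : MvPolynomial (Fin m) ℝ, A.IsHomogeneous 2 ∧ B.IsHomogeneous 3 ∧
      ∀ x : Fin (m + 1) → ℝ, eval (U.mulVec x) f = x (Fin.last m) ^ 3 +
        3 * x (Fin.last m) * eval (fun i : Fin m ↦ x i.castSucc) A +
          3 * eval (fun i : Fin m ↦ x i.castSucc) B
  obtain ⟨e, he, hmax⟩ := exists_isMaxOn_unit_sphere f
  have hone := eval_eq_one_of_isMax_of_eiconal hcubic heiconal he hmax
  have hhom := isHomogeneous_of_eval_smul hcubic
  obtain ⟨U, hU, hUe⟩ := Matrix.exists_mem_orthogonalGroup_col_eq (Fin.last m) he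
  let w : Fin (m + 1) → MvPolynomial (Fin m) ℝ := fun i ↦ ∑ j, C (U i j.castSucc) * X j
  have hw (i) : (w i).IsHomogeneous 1 := .sum _ _ _ fun j _ ↦ isHomogeneous_C_mul_X _ _
  have heval (y : Fin m → ℝ) (p : MvPolynomial (Fin (m + 1)) ℝ) :
      eval y (aeval w p) = eval (fun i ↦ eval y (w i)) p := by
    simpa [coe_aeval_eq_eval] using comp_aeval_apply w (aeval y : _ →ₐ[ℝ] ℝ) p
  refine ⟨U, hU, ∑ i, C (e i / 3) * aeval w (pderiv i f), C 3⁻¹ * aeval w f,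
    .sum _ _ _ fun i _ ↦ ?_, ?_, fun x ↦ ?_⟩
  · simpa using (hhom.pderiv.aeval w hw).C_mul (e i / 3)
  · simpa using (hhom.aeval w hw).C_mul 3⁻¹
  set y : Fin m → ℝ := fun i ↦ x i.castSucc
  set z : Fin (m + 1) → ℝ := fun i ↦ eval y (w i) with hz
  have hsplit : U.mulVec x = z + x (Fin.last m) • e := by
    ext i
    simp [hz, w, y, Matrix.mulVec, dotProduct, Fin.sum_univ_castSucc, hUe, mul_comm]
  have horth : ∑ i, e i * z i = 0 := by
    rw [Matrix.mem_orthogonalGroup_iff'] at hU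
    have hcol (j : Fin m) : ∑ i, e i * U i j.castSucc = 0 := by
      have h := congrFun (congrFun hU (Fin.last m)) j.castSucc
      simpa [Matrix.mul_apply, hUe, Matrix.one_apply, (Fin.castSucc_lt_last j).ne'] using h
    simp only [hz, w, map_sum, map_mul, eval_C, eval_X, Finset.mul_sum]
    rw [Finset.sum_comm]
    simp only [← mul_assoc, ← Finset.sum_mul, hcol, zero_mul, Finset.sum_const_zero]
  rw [hsplit, eval_add_smul_of_cubic hcubic, hone,
    sum_mul_pderiv_eq_zero_of_isMax hcubic he hmax horth]
  simp only [map_sum, map_mul, eval_C, heval, ← hz, div_mul_eq_mul_div, ← Finset.sum_div]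
  ring
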